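/- arXiv:1508.01500 — 2 statements merged into one kernel-verified Lean document; each statement's English description precedes it below -/
import Mathlib

section
/- Let u ∈ H^{1/2}₊(S¹) and ρ ∈ Σ_H(u). Let u_ρ and v_ρ denote the orthogonal projections of u and of the constant function 1 onto E_u(ρ) = ker(H_u² − ρ²I). Then ‖v_ρ‖² = ‖u_ρ‖² / ρ², where ‖·‖ is the L² norm. -/
open Complex Filter
open scoped ComplexConjugate Topology ENNReal

noncomputable section

/-- ℓ²(ℕ, ℂ): the sequence model of the Hardy space L²₊(S¹), identifying a function
with its sequence of nonnegative Fourier coefficients. -/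
abbrev Hardy : Type := lp (fun _ : ℕ => ℂ) 2

/-- A coefficient sequence belongs to L²₊. -/
def MemL2 (u : ℕ → ℂ) : Prop := Memℓp u 2

/-- A coefficient sequence belongs to the Sobolev space H^s₊. -/
def MemHs (s : ℝ) (u : ℕ → ℂ) : Prop :=
  Summable fun n : ℕ => ((1 : ℝ) + (n : ℝ) ^ 2) ^ s * ‖u n‖ ^ 2

/-- The squared H^s norm of a coefficient sequence. -/
def hsNormSq (s : ℝ) (u : ℕ → ℂ) : ℝ :=
  ∑' n : ℕ, ((1 : ℝ) + (n : ℝ) ^ 2) ^ s * ‖u n‖ ^ 2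

/-- The L² inner product (f|g), ℂ-linear in the first argument. -/
def hinner (f g : ℕ → ℂ) : ℂ := ∑' n : ℕ, f n * conj (g n)

/-- The squared L² norm. -/
def l2normSq (f : ℕ → ℂ) : ℝ := ∑' n : ℕ, ‖f n‖ ^ 2

/-- Coefficients of the constant function 1. -/
def oneSeq : ℕ → ℂ := fun n => if n = 0 then 1 else 0

/-- The Hankel operator H_u(h) = Π(u ⬝ conj h) in Fourier coefficients. -/
def hankel (u h : ℕ → ℂ) : ℕ → ℂ := fun k => ∑' ℓ : ℕ, u (k + ℓ) * conj (h ℓ)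

/-- The shifted Hankel operator K_u = T_z^* ∘ H_u in Fourier coefficients. -/
def khankel (u h : ℕ → ℂ) : ℕ → ℂ := fun k => ∑' ℓ : ℕ, u (k + 1 + ℓ) * conj (h ℓ)

/-- H_u². -/
def hu2 (u h : ℕ → ℂ) : ℕ → ℂ := hankel u (hankel u h)

/-- K_u². -/
def ku2 (u h : ℕ → ℂ) : ℕ → ℂ := khankel u (khankel u h)

/-- The m-th Fourier coefficient of |u|², m ∈ ℤ. -/
def absSqCoeff (u : ℕ → ℂ) (m : ℤ) : ℂ :=
  ∑' q : ℕ × ℕ, if ((q.1 : ℤ) - (q.2 : ℤ) = m) then u q.1 * conj (u q.2) else 0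

/-- The Toeplitz operator T_{|u|²} in Fourier coefficients. -/
def toeplitzAbsSq (u h : ℕ → ℂ) : ℕ → ℂ :=
  fun k => ∑' ℓ : ℕ, absSqCoeff u ((k : ℤ) - (ℓ : ℤ)) * h ℓ

/-- Fourier coefficients of Π(|u|²u). -/
def cubic (u : ℕ → ℂ) : ℕ → ℂ := fun n =>
  ∑' q : ℕ × ℕ × ℕ, if q.1 + q.2.2 = q.2.1 + n then u q.1 * conj (u q.2.1) * u q.2.2 else 0

/-- `u : ℝ → (ℕ → ℂ)` solves the α-Szegő equation i ∂ₜ u = Π(|u|²u) + α(u|1),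
written coefficientwise on nonnegative Fourier modes. -/
def SolvesSzego (α : ℝ) (u : ℝ → ℕ → ℂ) : Prop :=
  ∀ n t, HasDerivAt (fun τ => u τ n)
    (-Complex.I * (cubic (u t) n + (α : ℂ) * u t 0 * oneSeq n)) t

/-- `u` is a smooth curve valued in H^s₊. -/
def SmoothHsCurve (s : ℝ) (u : ℝ → ℕ → ℂ) : Prop :=
  (∀ t, MemHs s (u t)) ∧ ∀ n, ContDiff ℝ (⊤ : ℕ∞) fun t => u t n

/-- `u` is a continuous curve valued in H^s₊. -/
def ContHsCurve (s : ℝ) (u : ℝ → ℕ → ℂ) : Prop :=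
  (∀ t, MemHs s (u t)) ∧
    ∀ t₀ : ℝ, Tendsto (fun t => hsNormSq s (fun n => u t n - u t₀ n)) (𝓝 t₀) (𝓝 0)

/-- E_u(τ) = ker(H_u² − τ² I) as a subset of ℓ². -/
def Espace (u : ℕ → ℂ) (τ : ℝ) : Set (ℕ → ℂ) :=
  {h | MemL2 h ∧ hu2 u h = ((τ : ℂ) ^ 2) • h}

/-- F_u(τ) = ker(K_u² − τ² I) as a subset of ℓ². -/
def Fspace (u : ℕ → ℂ) (τ : ℝ) : Set (ℕ → ℂ) :=
  {h | MemL2 h ∧ ku2 u h = ((τ : ℂ) ^ 2) • h}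

/-- Σ_H(u): τ > 0 such that E_u(τ) is not orthogonal to u. -/
def SigmaH (u : ℕ → ℂ) : Set ℝ :=
  {τ : ℝ | 0 < τ ∧ ∃ v ∈ Espace u τ, hinner u v ≠ 0}

/-- Σ_K(u): τ ≥ 0 such that F_u(τ) is not orthogonal to u. -/
def SigmaK (u : ℕ → ℂ) : Set ℝ :=
  {τ : ℝ | 0 ≤ τ ∧ ∃ v ∈ Fspace u τ, hinner u v ≠ 0}

/-- `p` is the orthogonal projection of `w` on the subspace `V` of ℓ². -/
def IsOrthProj (V : Set (ℕ → ℂ)) (w p : ℕ → ℂ) : Prop :=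
  p ∈ V ∧ ∀ v ∈ V, hinner (w - p) v = 0

/-- The rank of the shifted Hankel operator K_u. -/
def kuRank (u : ℕ → ℂ) : Cardinal :=
  Module.rank ℂ (Submodule.span ℂ (khankel u '' {h | MemL2 h}))

/-- The rank of the Hankel operator H_u. -/
def huRank (u : ℕ → ℂ) : Cardinal :=
  Module.rank ℂ (Submodule.span ℂ (hankel u '' {h | MemL2 h}))

/-- ℒ(N) : rank K_u = N. -/
def InLN (N : ℕ) (u : ℕ → ℂ) : Prop := MemL2 u ∧ kuRank u = N

/-- The constant function 1 as an element of ℓ². -/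
def oneH : Hardy := lp.single 2 0 1

lemma memL2_iff_summable {f : ℕ → ℂ} : MemL2 f ↔ Summable fun n => ‖f n‖ ^ 2 := by
  rw [MemL2, memℓp_gen_iff (by simp)]
  simp

lemma summable_mul_conj {ι : Type*} {f g : ι → ℂ} (hf : Summable fun i => ‖f i‖ ^ 2)
    (hg : Summable fun i => ‖g i‖ ^ 2) : Summable fun i => f i * conj (g i) := by
  refine Summable.of_norm_bounded (hf.add hg) fun i => ?_
  rw [norm_mul, RCLike.norm_conj]
  nlinarith [sq_nonneg (‖f i‖ - ‖g i‖), norm_nonneg (f i), norm_nonneg (g i)]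

lemma norm_tsum_mul_conj_sq_le {f g : ℕ → ℂ} (hf : Summable fun i => ‖f i‖ ^ 2)
    (hg : Summable fun i => ‖g i‖ ^ 2) :
    ‖∑' i, f i * conj (g i)‖ ^ 2 ≤ (∑' i, ‖f i‖ ^ 2) * ∑' i, ‖g i‖ ^ 2 := by
  obtain ⟨hs, hle⟩ := Real.summable_and_inner_le_Lp_mul_Lq_tsum_of_nonneg
    Real.HolderConjugate.two_two (fun i => norm_nonneg (f i)) (fun i => norm_nonneg (g i))
    (by simpa using hf) (by simpa using hg)
  have hnorm : ‖∑' i, f i * conj (g i)‖ ≤ ∑' i, ‖f i‖ * ‖g i‖ := by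
    refine (norm_tsum_le_tsum_norm (by simpa using hs)).trans_eq ?_
    simp
  simp only [Real.rpow_two, ← Real.sqrt_eq_rpow] at hle
  refine (pow_le_pow_left₀ (norm_nonneg _) (hnorm.trans hle) 2).trans_eq ?_
  rw [mul_pow, Real.sq_sqrt (tsum_nonneg fun i => sq_nonneg _),
    Real.sq_sqrt (tsum_nonneg fun i => sq_nonneg _)]

/-- The Hankel matrix of a symbol in `H^{1/2}₊` is square summable (Hilbert–Schmidt). -/
lemma MemHs.summable_hankel_matrix {u : ℕ → ℂ} (hu : MemHs (1 / 2) u) :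
    Summable fun x : ℕ × ℕ => ‖u (x.1 + x.2)‖ ^ 2 := by
  rw [← Finset.HasAntidiagonal.sigmaAntidiagonalEquivProd.summable_iff]
  have hentry : ∀ (n : ℕ) (x : Finset.HasAntidiagonal.antidiagonal n),
      ‖u (x.1.1 + x.1.2)‖ ^ 2 = ‖u n‖ ^ 2 :=
    fun n x => by rw [Finset.HasAntidiagonal.mem_antidiagonal.1 x.2]
  refine (summable_sigma_of_nonneg fun _ => sq_nonneg _).2 ⟨fun n => Summable.of_finite, ?_⟩
  refine Summable.of_nonneg_of_le (fun n => tsum_nonneg fun _ => sq_nonneg _) (fun n => ?_)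
    (Summable.mul_left 2 hu)
  have hrow : ∑' x : Finset.HasAntidiagonal.antidiagonal n, ‖u (x.1.1 + x.1.2)‖ ^ 2 =
      (n + 1) * ‖u n‖ ^ 2 := by
    simp [hentry, tsum_fintype]
  refine hrow.trans_le ?_
  rw [← Real.sqrt_eq_rpow, ← mul_assoc]
  have hsqrt_one : 1 ≤ √(1 + (n : ℝ) ^ 2) := Real.one_le_sqrt.2 (by nlinarith)
  have hsqrt_n : (n : ℝ) ≤ √(1 + (n : ℝ) ^ 2) := Real.le_sqrt_of_sq_le (by linarith)
  gcongr
  linarith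

lemma MemHs.summable_norm_sq {u : ℕ → ℂ} (hu : MemHs (1 / 2) u) (k : ℕ) :
    Summable fun l => ‖u (k + l)‖ ^ 2 :=
  hu.summable_hankel_matrix.prod_factor k

lemma memL2_hankel {u f : ℕ → ℂ} (hu : MemHs (1 / 2) u) (hf : MemL2 f) :
    MemL2 (hankel u f) := by
  rw [memL2_iff_summable] at hf ⊢
  exact Summable.of_nonneg_of_le (fun _ => sq_nonneg _)
    (fun k => norm_tsum_mul_conj_sq_le (hu.summable_norm_sq k) hf)
    (hu.summable_hankel_matrix.prod.mul_right _)

lemma hinner_hankel_comm {u f g : ℕ → ℂ} (hu : MemHs (1 / 2) u) (hf : MemL2 f)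
    (hg : MemL2 g) : hinner (hankel u f) g = hinner (hankel u g) f := by
  rw [memL2_iff_summable] at hf hg
  have hfg : Summable fun x : ℕ × ℕ => ‖g x.1 * f x.2‖ ^ 2 := by
    simpa [mul_pow] using hg.mul_of_nonneg hf (fun _ => sq_nonneg _) fun _ => sq_nonneg _
  have hsum := summable_mul_conj hu.summable_hankel_matrix hfg
  calc hinner (hankel u f) g
      = ∑' k, ∑' l, u (k + l) * conj (g k * f l) := by
        simp only [hinner, hankel, ← tsum_mul_right, map_mul]
        exact tsum_congr fun k => tsum_congr fun l => by ring
    _ = ∑' l, ∑' k, u (k + l) * conj (g k * f l) := hsum.tsum_comm.symm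
    _ = hinner (hankel u g) f := by
        simp only [hinner, hankel, ← tsum_mul_right, map_mul]
        exact tsum_congr fun l => tsum_congr fun k => by rw [add_comm k l]; ring

lemma hankel_smul (u h : ℕ → ℂ) (c : ℂ) : hankel u (c • h) = conj c • hankel u h := by
  funext k
  simp only [hankel, Pi.smul_apply, smul_eq_mul, map_mul, ← tsum_mul_left]
  exact tsum_congr fun l => by ring

lemma hankel_mem_Espace {u h : ℕ → ℂ} {τ : ℝ} (hu : MemHs (1 / 2) u) (hh : h ∈ Espace u τ) :
    hankel u h ∈ Espace u τ := by
  refine ⟨memL2_hankel hu hh.1, ?_⟩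
  change hankel u (hu2 u h) = _
  rw [hh.2, hankel_smul, map_pow, conj_ofReal]

lemma hinner_conj_symm (f g : ℕ → ℂ) : conj (hinner f g) = hinner g f := by
  rw [hinner, hinner, conj_tsum]
  simp [mul_comm]

lemma hinner_sub_left {f g h : ℕ → ℂ} (hf : MemL2 f) (hg : MemL2 g) (hh : MemL2 h) :
    hinner (f - g) h = hinner f h - hinner g h := by
  rw [memL2_iff_summable] at hf hg hh
  simp only [hinner, Pi.sub_apply, sub_mul]
  exact (summable_mul_conj hf hh).tsum_sub (summable_mul_conj hg hh)

lemma hinner_smul_left (c : ℂ) (f g : ℕ → ℂ) : hinner (c • f) g = c * hinner f g := by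
  simp only [hinner, Pi.smul_apply, smul_eq_mul, mul_assoc, tsum_mul_left]

lemma hinner_self (f : ℕ → ℂ) : hinner f f = l2normSq f := by
  simp only [hinner, l2normSq, ofReal_tsum, ofReal_pow, mul_conj']

lemma hinner_oneSeq (f : ℕ → ℂ) : hinner oneSeq f = conj (f 0) := by
  rw [hinner, tsum_eq_single 0 fun n hn => by simp [oneSeq, hn]]
  simp [oneSeq]

lemma memL2_oneSeq : MemL2 oneSeq :=
  memL2_iff_summable.2 <| summable_of_ne_finset_zero (s := {0}) fun n hn => by
    simp [oneSeq, Finset.notMem_singleton.1 hn]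

lemma hankel_zero_eq_hinner (u h : ℕ → ℂ) : hankel u h 0 = hinner u h := by
  simp [hankel, hinner]

lemma IsOrthProj.hinner_eq {V : Set (ℕ → ℂ)} {w p v : ℕ → ℂ} (hp : IsOrthProj V w p)
    (hV : ∀ h ∈ V, MemL2 h) (hw : MemL2 w) (hv : v ∈ V) : hinner w v = hinner p v :=
  sub_eq_zero.1 <| by rw [← hinner_sub_left hw (hV p hp.1) (hV v hv), hp.2 v hv]

/-- If `ρ ∈ Σ_H(u)` and `u_ρ`, `v_ρ` are the orthogonal projections of
`u` and of the constant function `1` onto `E_u(ρ)`, then `‖v_ρ‖² = ‖u_ρ‖²/ρ²`. -/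
theorem norm_projection_one_onto_Espace (u : ℕ → ℂ) (hu : MemHs (1/2) u)
    (ρ : ℝ) (hρ : ρ ∈ SigmaH u) (p q : ℕ → ℂ)
    (hp : IsOrthProj (Espace u ρ) u p) (hq : IsOrthProj (Espace u ρ) oneSeq q) :
    l2normSq q = l2normSq p / ρ ^ 2 := by
  have hE : ∀ h ∈ Espace u ρ, MemL2 h := fun h hh => hh.1
  have huL : MemL2 u := memL2_iff_summable.2 (by simpa using hu.summable_norm_sq 0)
  have hHq := hankel_mem_Espace hu hq.1
  have hadj : ∀ v ∈ Espace u ρ, hinner (hankel u q) v = hinner p v := fun v hv => by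
    rw [hinner_hankel_comm hu (hE q hq.1) (hE v hv), ← hinner_conj_symm,
      ← hq.hinner_eq hE memL2_oneSeq (hankel_mem_Espace hu hv), hinner_oneSeq, conj_conj,
      hankel_zero_eq_hinner, hp.hinner_eq hE huL hv]
  have hHq_norm : hinner (hankel u q) (hankel u q) = hinner p p := by
    rw [← hadj p hp.1, ← hinner_conj_symm p, ← hadj _ hHq, hinner_conj_symm]
  have hnorm : hinner p p = (ρ : ℂ) ^ 2 * hinner q q := by
    rw [← hHq_norm, hinner_hankel_comm hu (hE q hq.1) (hE _ hHq), ← hinner_smul_left, ← hq.1.2]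
    rfl
  rw [hinner_self, hinner_self] at hnorm
  rw [eq_div_iff (pow_ne_zero 2 hρ.1.ne'), mul_comm]
  exact_mod_cast hnorm.symm

end
end

section
/- Let u ∈ H^{1/2}₊(S¹) and let x ∈ ℝ satisfy x·‖H_u‖_op² < 1 (so that I − xH_u² and I − xK_u² are invertible). Define J_x(u) := ((I − xH_u²)^{-1} 1 | 1), Z_x(u) := (1 | (I − xH_u²)^{-1} u), F_x(u) := ((I − xK_u²)^{-1} u | u), E_x(u) := ((I − xK_u²)^{-1} 1 | 1). Then J_x(u) > 0, and: for x ≠ 0, F_x(u) = (J_x(u) − 1)/(x·J_x(u)); and E_x(u) = J_x(u) − x·|Z_x(u)|²/J_x(u). -/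
open Complex Filter
open scoped ComplexConjugate Topology ENNReal

noncomputable section

/-- The squared operator norm of the Hankel operator H_u on ℓ². -/
def huOpNormSq (u : ℕ → ℂ) : ℝ :=
  sSup {r : ℝ | ∃ h : ℕ → ℂ, MemL2 h ∧ l2normSq h = 1 ∧ r = l2normSq (hankel u h)}

/-- A square-integrable Hankel symbol: `∑_{k,ℓ} |u (k + ℓ)|² < ∞` for `u ∈ H^{1/2}₊`. -/
theorem MemHs.summable_hankel {u : ℕ → ℂ} (hu : MemHs (1 / 2) u) :
    Summable fun p : ℕ × ℕ => ‖u (p.1 + p.2)‖ ^ 2 := by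
  rw [← Finset.HasAntidiagonal.sigmaAntidiagonalEquivProd.summable_iff, summable_sigma_of_nonneg
    (fun _ => by simp only [Function.comp_apply]; positivity)]
  refine ⟨fun n => Summable.of_finite, ?_⟩
  refine Summable.of_nonneg_of_le (fun n => tsum_nonneg fun _ => by
    simp only [Function.comp_apply]; positivity) (fun n => ?_) (hu.mul_left 2)
  have hconst : ∀ y : Finset.HasAntidiagonal.antidiagonal n,
      ((fun p : ℕ × ℕ => ‖u (p.1 + p.2)‖ ^ 2) ∘
        Finset.HasAntidiagonal.sigmaAntidiagonalEquivProd) ⟨n, y⟩ = ‖u n‖ ^ 2 := by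
    rintro ⟨⟨a, b⟩, hy⟩
    rw [Finset.HasAntidiagonal.mem_antidiagonal] at hy
    simp at hy
    simp [hy]
  simp only [hconst, tsum_fintype, Finset.sum_const, Finset.card_univ, Fintype.card_coe,
    Finset.Nat.card_antidiagonal, nsmul_eq_mul]
  rw [← mul_assoc, ← Real.sqrt_eq_rpow]
  refine mul_le_mul_of_nonneg_right ?_ (by positivity)
  have hsq : Real.sqrt (1 + (n : ℝ) ^ 2) ^ 2 = 1 + (n : ℝ) ^ 2 := Real.sq_sqrt (by positivity)
  push_cast
  nlinarith [Real.sqrt_nonneg (1 + (n : ℝ) ^ 2), sq_nonneg ((n : ℝ) - 1)]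

theorem Hardy.summable_sq (h : Hardy) : Summable fun n => ‖h n‖ ^ 2 := by
  simpa using (lp.memℓp h).summable (by norm_num)

theorem Hardy.norm_sq_eq (h : Hardy) : ‖h‖ ^ 2 = l2normSq h := by
  simpa [l2normSq] using lp.norm_rpow_eq_tsum (p := 2) (by norm_num) h

theorem memL2_of_summable_sq {h : ℕ → ℂ} (hh : Summable fun n => ‖h n‖ ^ 2) : MemL2 h :=
  memℓp_gen (by simpa using hh)

theorem Hardy.hinner_eq (f g : Hardy) : hinner f g = inner ℂ g f := by
  rw [lp.inner_eq_tsum]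
  rfl

theorem summable_hankel_row {u : ℕ → ℂ} (hs : Summable fun p : ℕ × ℕ => ‖u (p.1 + p.2)‖ ^ 2)
    (k : ℕ) : Summable fun l => ‖u (k + l)‖ ^ 2 :=
  hs.prod_factor k

theorem summable_hankel_apply {u : ℕ → ℂ}
    (hs : Summable fun p : ℕ × ℕ => ‖u (p.1 + p.2)‖ ^ 2) (h : Hardy) (k : ℕ) :
    Summable fun l => u (k + l) * conj (h l) :=
  lp.summable_inner (𝕜 := ℂ) h ⟨_, memL2_of_summable_sq (summable_hankel_row hs k)⟩

theorem norm_sq_hankel_le {u : ℕ → ℂ}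
    (hs : Summable fun p : ℕ × ℕ => ‖u (p.1 + p.2)‖ ^ 2) (h : Hardy) (k : ℕ) :
    ‖hankel u h k‖ ^ 2 ≤ (∑' l, ‖u (k + l)‖ ^ 2) * ‖h‖ ^ 2 := by
  let w : Hardy := ⟨_, memL2_of_summable_sq (summable_hankel_row hs k)⟩
  have hw : hankel u h k = inner ℂ h w := Hardy.hinner_eq w h
  have hn : ‖w‖ ^ 2 = ∑' l, ‖u (k + l)‖ ^ 2 := Hardy.norm_sq_eq w
  rw [hw, ← hn, ← mul_pow, mul_comm]
  gcongr
  exact norm_inner_le_norm h w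

theorem summable_sq_hankel {u : ℕ → ℂ}
    (hs : Summable fun p : ℕ × ℕ => ‖u (p.1 + p.2)‖ ^ 2) (h : Hardy) :
    Summable fun k => ‖hankel u h k‖ ^ 2 :=
  Summable.of_nonneg_of_le (fun _ => by positivity) (norm_sq_hankel_le hs h)
    (hs.prod.mul_right _)

/-- The Hankel operator as an antilinear map of the Hardy space. -/
def hankelOp {u : ℕ → ℂ} (hs : Summable fun p : ℕ × ℕ => ‖u (p.1 + p.2)‖ ^ 2) :
    Hardy →ₛₗ[starRingEnd ℂ] Hardy where
  toFun h := ⟨hankel u h, memL2_of_summable_sq (summable_sq_hankel hs h)⟩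
  map_add' f g := by
    ext k
    change hankel u (⇑(f + g)) k = hankel u f k + hankel u g k
    simp only [hankel, lp.coeFn_add, Pi.add_apply, map_add, mul_add]
    exact (summable_hankel_apply hs f k).tsum_add (summable_hankel_apply hs g k)
  map_smul' c f := by
    ext k
    change hankel u (⇑(c • f)) k = conj c * hankel u f k
    simp only [hankel, lp.coeFn_smul, Pi.smul_apply, smul_eq_mul, map_mul, ← tsum_mul_left]
    exact tsum_congr fun l => by ring

theorem coe_hankelOp {u : ℕ → ℂ} (hs : Summable fun p : ℕ × ℕ => ‖u (p.1 + p.2)‖ ^ 2)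
    (h : Hardy) : ⇑(hankelOp hs h) = hankel u h := rfl

theorem inner_hankelOp_comm {u : ℕ → ℂ}
    (hs : Summable fun p : ℕ × ℕ => ‖u (p.1 + p.2)‖ ^ 2) (f g : Hardy) :
    inner ℂ g (hankelOp hs f) = inner ℂ f (hankelOp hs g) := by
  have hfg : Summable fun p : ℕ × ℕ => ‖g p.1‖ ^ 2 * ‖f p.2‖ ^ 2 :=
    g.summable_sq.mul_of_nonneg f.summable_sq (fun _ => by positivity) (fun _ => by positivity)
  have hsum : Summable (Function.uncurry fun k l : ℕ =>
      u (k + l) * conj (f l : ℂ) * conj (g k : ℂ)) := by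
    refine Summable.of_norm_bounded (hs.add hfg) fun p => ?_
    simp only [Function.uncurry, norm_mul, RCLike.norm_conj]
    nlinarith [sq_nonneg (‖u (p.1 + p.2)‖ - ‖g p.1‖ * ‖f p.2‖), sq_nonneg (‖u (p.1 + p.2)‖),
      sq_nonneg (‖g p.1‖ * ‖f p.2‖)]
  rw [← Hardy.hinner_eq, ← Hardy.hinner_eq, coe_hankelOp, coe_hankelOp]
  simp only [hinner, hankel, ← tsum_mul_right]
  refine (Summable.tsum_comm hsum).symm.trans ?_
  exact tsum_congr fun l => tsum_congr fun k => by rw [add_comm k l]; ring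

theorem oneH_apply (k : ℕ) : oneH k = oneSeq k := by
  simp [oneH, oneSeq, lp.single_apply, Pi.single_apply]

theorem coe_oneH : ⇑oneH = oneSeq := funext oneH_apply

theorem oneH_ne_zero : oneH ≠ 0 := fun h => by
  simpa [h, oneSeq] using oneH_apply 0

theorem hankelOp_oneH {u : ℕ → ℂ} (hs : Summable fun p : ℕ × ℕ => ‖u (p.1 + p.2)‖ ^ 2)
    (humem : Memℓp u 2) : hankelOp hs oneH = ⟨u, humem⟩ := by
  ext k
  change hankel u oneH k = u k
  rw [hankel, tsum_eq_single 0 (fun l hl => by simp [oneH_apply, oneSeq, hl])]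
  simp [oneH_apply, oneSeq]

/-- The rank-one relation `K_u² = H_u² - (· | u) u`. -/
theorem ku2_eq_sub {u : ℕ → ℂ} (hs : Summable fun p : ℕ × ℕ => ‖u (p.1 + p.2)‖ ^ 2)
    (humem : Memℓp u 2) (h : Hardy) (k : ℕ) :
    ku2 u h k = hu2 u h k - inner ℂ (⟨u, humem⟩ : Hardy) h * u k := by
  have hshift : ∀ l, khankel u h l = hankel u h (l + 1) := fun _ => rfl
  have hzero : inner ℂ (⟨u, humem⟩ : Hardy) h = conj (hankel u h 0) := by
    rw [← inner_conj_symm, ← Hardy.hinner_eq]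
    simp [hinner, hankel]
  have hsplit := (summable_hankel_apply hs (hankelOp hs h) k).tsum_eq_zero_add
  simp only [coe_hankelOp, add_zero] at hsplit
  rw [hzero, ku2, hu2, hankel, hsplit, khankel]
  simp only [hshift]
  rw [mul_comm (u k), add_sub_cancel_left]
  exact tsum_congr fun l => by rw [add_right_comm, add_assoc]

theorem norm_sq_hankelOp_le {u : ℕ → ℂ}
    (hs : Summable fun p : ℕ × ℕ => ‖u (p.1 + p.2)‖ ^ 2) (h : Hardy) :
    ‖hankelOp hs h‖ ^ 2 ≤ huOpNormSq u * ‖h‖ ^ 2 := by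
  rcases eq_or_ne h 0 with rfl | hne
  · simp
  have hpos : 0 < ‖h‖ := norm_pos_iff.2 hne
  have hbdd : BddAbove {r : ℝ | ∃ h : ℕ → ℂ, MemL2 h ∧ l2normSq h = 1 ∧
      r = l2normSq (hankel u h)} := by
    refine ⟨∑' k, ∑' l, ‖u (k + l)‖ ^ 2, ?_⟩
    rintro r ⟨g, hg, hg1, rfl⟩
    let G : Hardy := ⟨g, hg⟩
    have hG : ‖G‖ ^ 2 = 1 := (Hardy.norm_sq_eq G).trans hg1
    refine Summable.tsum_le_tsum (fun k => ?_) (summable_sq_hankel hs G) hs.prod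
    simpa [hG] using norm_sq_hankel_le hs G k
  let g : Hardy := ((‖h‖⁻¹ : ℝ) : ℂ) • h
  have hg1 : ‖g‖ ^ 2 = 1 := by
    rw [norm_smul, Complex.norm_real, norm_inv, norm_norm, inv_mul_cancel₀ hpos.ne', one_pow]
  have hle : ‖hankelOp hs g‖ ^ 2 ≤ huOpNormSq u :=
    le_csSup hbdd ⟨g, lp.memℓp g, by rw [← Hardy.norm_sq_eq, hg1], Hardy.norm_sq_eq _⟩
  rw [map_smulₛₗ, norm_smul, RCLike.norm_conj, Complex.norm_real, norm_inv, norm_norm, mul_pow,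
    inv_pow, inv_mul_eq_div, div_le_iff₀ (by positivity)] at hle
  exact hle

section AbstractResolvent

variable {E : Type*} [NormedAddCommGroup E] [InnerProductSpace ℂ E]
  {A : E →ₛₗ[starRingEnd ℂ] E} {x : ℝ} {e f g : E}

theorem map_resolvent_eq (hf : f - (x : ℂ) • A (A f) = e) :
    A f - (x : ℂ) • A (A (A f)) = A e := by
  rw [← hf, map_sub, map_smulₛₗ, Complex.conj_ofReal]

theorem inner_resolvent_eq (hA : ∀ a b, inner ℂ b (A a) = inner ℂ a (A b))
    (hf : f - (x : ℂ) • A (A f) = e) :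
    inner ℂ e f = ((‖f‖ ^ 2 - x * ‖A f‖ ^ 2 : ℝ) : ℂ) := by
  have h : inner ℂ f (A (A f)) = (‖A f‖ : ℂ) ^ 2 := by
    rw [hA, inner_self_eq_norm_sq_to_K]; rfl
  have h' : inner ℂ (A (A f)) f = (‖A f‖ : ℂ) ^ 2 := by
    rw [← inner_conj_symm, h, map_pow, Complex.conj_ofReal]
  rw [← hf, inner_sub_left, inner_smul_left, h', inner_self_eq_norm_sq_to_K, Complex.conj_ofReal]
  push_cast
  rfl

theorem inner_map_resolvent (hA : ∀ a b, inner ℂ b (A a) = inner ℂ a (A b))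
    (hf : f - (x : ℂ) • A (A f) = e) (hreal : conj (inner ℂ e f) = inner ℂ e f)
    (he : inner ℂ e e = 1) :
    (x : ℂ) * inner ℂ (A e) (A f) = inner ℂ e f - 1 := by
  have h : (x : ℂ) * inner ℂ e (A (A f)) = inner ℂ e f - 1 := by
    rw [← he, ← inner_smul_right, ← inner_sub_right]
    congr 1
    rw [← hf]; abel
  rw [← inner_conj_symm, ← hA, ← Complex.conj_ofReal, ← map_mul, h, map_sub, hreal, map_one]

/-- A solution `p` of `(I - x K²) p = b`, with `K² = A² - (· | A e) A e`, in terms of the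
resolvent of `A²`. -/
theorem rank_one_resolvent {b p q : E} (hinj : ∀ h : E, h - (x : ℂ) • A (A h) = 0 → h = 0)
    (hA : ∀ c : ℂ, ∀ h : E, A (A (c • h)) = c • A (A h))
    (hg : g - (x : ℂ) • A (A g) = A e) (hq : q - (x : ℂ) • A (A q) = b)
    (hp : p - (x : ℂ) • (A (A p) - inner ℂ (A e) p • A e) = b) :
    p = q - ((x : ℂ) * inner ℂ (A e) p) • g := by
  refine sub_eq_zero.1 (hinj _ ?_)
  simp only [map_sub, hA]
  have h : p - (q - ((x : ℂ) * inner ℂ (A e) p) • g) - (x : ℂ) • (A (A p) - (A (A q)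
      - ((x : ℂ) * inner ℂ (A e) p) • A (A g)))
      = (p - (x : ℂ) • (A (A p) - inner ℂ (A e) p • A e)) - (q - (x : ℂ) • A (A q))
        + ((x : ℂ) * inner ℂ (A e) p) • ((g - (x : ℂ) • A (A g)) - A e) := by
    module
  rw [h, hp, hq, hg]
  simp

end AbstractResolvent

/-- With `J_x(u) = ((I−xH_u²)⁻¹1|1)`, `Z_x(u) = (1|(I−xH_u²)⁻¹u)`,
`F_x(u) = ((I−xK_u²)⁻¹u|u)`, `E_x(u) = ((I−xK_u²)⁻¹1|1)`, one has `J_x(u) > 0`,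
`F_x(u) = (J_x(u)−1)/(x J_x(u))` for `x ≠ 0`, and `E_x(u) = J_x(u) − x|Z_x(u)|²/J_x(u)`. -/
theorem resolvent_identities_JZEF (u : ℕ → ℂ) (hu : MemHs (1/2) u)
    (humem : Memℓp u 2) (x : ℝ) (hx : x * huOpNormSq u < 1)
    (RH RK : Hardy →L[ℂ] Hardy)
    (hRH : ∀ h : Hardy, ∀ k, (RH h) k - (x : ℂ) * hu2 u (⇑(RH h)) k = h k)
    (hRHbij : Function.Bijective (⇑RH))
    (hRK : ∀ h : Hardy, ∀ k, (RK h) k - (x : ℂ) * ku2 u (⇑(RK h)) k = h k)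
    (hRKbij : Function.Bijective (⇑RK)) :
    ∀ J Z : ℂ, J = hinner (⇑(RH oneH)) oneSeq → Z = hinner oneSeq (⇑(RH ⟨u, humem⟩)) →
      J.im = 0 ∧ 0 < J.re ∧
      (x ≠ 0 → hinner (⇑(RK ⟨u, humem⟩)) u = (J - 1) / ((x : ℂ) * J)) ∧
      hinner (⇑(RK oneH)) oneSeq = J - (x : ℂ) * (Z * conj Z) / J := by
  have hs := hu.summable_hankel
  let A := hankelOp hs
  let v : Hardy := ⟨u, humem⟩
  have hAe : A oneH = v := hankelOp_oneH hs humem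
  have hA : ∀ a b, inner ℂ b (A a) = inner ℂ a (A b) := inner_hankelOp_comm hs
  have hAA : ∀ c : ℂ, ∀ h, A (A (c • h)) = c • A (A h) := fun c h => by
    rw [map_smulₛₗ, map_smulₛₗ, Complex.conj_conj]
  have hH : ∀ h, RH h - (x : ℂ) • A (A (RH h)) = h := fun h => by
    ext k
    exact hRH h k
  have hK : ∀ h, RK h - (x : ℂ) • (A (A (RK h)) - inner ℂ (A oneH) (RK h) • A oneH) = h := by
    intro h
    ext k
    rw [hAe]
    have hk := hRK h k
    rw [ku2_eq_sub hs humem] at hk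
    exact hk
  have hinj : ∀ h, h - (x : ℂ) • A (A h) = 0 → h = 0 := by
    intro h hh
    obtain ⟨k, rfl⟩ := hRHbij.2 h
    rw [hH] at hh
    rw [hh, map_zero]
  set f := RH oneH with hf
  have hff : f - (x : ℂ) • A (A f) = oneH := hH oneH
  have hgg : A f - (x : ℂ) • A (A (A f)) = A oneH := map_resolvent_eq hff
  have hg : RH v = A f := by
    refine sub_eq_zero.1 (hinj _ ?_)
    have hv := hH v
    simp only [map_sub, smul_sub]
    rw [sub_sub_sub_comm, hv, hgg, hAe, sub_self]
  have hone : inner ℂ oneH oneH = (1 : ℂ) := by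
    rw [← Hardy.hinner_eq, coe_oneH, hinner, tsum_eq_single 0 (fun l hl => by simp [oneSeq, hl])]
    simp [oneSeq]
  have hf0 : f ≠ 0 := fun h0 => oneH_ne_zero (hRHbij.1 (h0.trans (map_zero RH).symm))
  have hfpos : 0 < ‖f‖ ^ 2 := by have := norm_pos_iff.2 hf0; positivity
  have hJpos : 0 < ‖f‖ ^ 2 - x * ‖A f‖ ^ 2 := by
    have hle : ‖A f‖ ^ 2 ≤ huOpNormSq u * ‖f‖ ^ 2 := norm_sq_hankelOp_le hs f
    rcases le_total x 0 with h | h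
    · nlinarith [mul_nonneg (neg_nonneg.2 h) (sq_nonneg ‖A f‖)]
    · nlinarith [mul_le_mul_of_nonneg_left hle h, mul_pos (sub_pos.2 hx) hfpos]
  have hJ : inner ℂ oneH f = ((‖f‖ ^ 2 - x * ‖A f‖ ^ 2 : ℝ) : ℂ) := inner_resolvent_eq hA hff
  have hreal : conj (inner ℂ oneH f : ℂ) = inner ℂ oneH f := by rw [hJ, Complex.conj_ofReal]
  have hG := inner_map_resolvent hA hff hreal hone
  rintro J Z hJdef hZdef
  have hJe : J = inner ℂ oneH f := by rw [hJdef, ← coe_oneH, Hardy.hinner_eq]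
  have hZe : Z = inner ℂ (A f) oneH := by
    rw [hZdef, ← coe_oneH, Hardy.hinner_eq, ← hg]
  have hJ0 : J ≠ 0 := by rw [hJe, hJ]; exact_mod_cast hJpos.ne'
  have hcZ : conj Z = inner ℂ oneH (A f) := by rw [hZe, inner_conj_symm]
  have hfu : inner ℂ (A oneH) f = Z := by
    rw [hZe, ← inner_conj_symm, ← hA f oneH, inner_conj_symm]
  rw [← hJe] at hG
  refine ⟨by rw [hJe, hJ, Complex.ofReal_im], by rwa [hJe, hJ, Complex.ofReal_re], ?_, ?_⟩
  · intro hx0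
    have hp := rank_one_resolvent hinj hAA hgg (hgg.trans hAe) (hK v)
    have hF := congrArg (inner ℂ (A oneH)) hp
    rw [inner_sub_right, inner_smul_right] at hF
    have hgoal : hinner (⇑(RK v)) u = inner ℂ (A oneH) (RK v) := by
      rw [hAe]; exact Hardy.hinner_eq (RK v) v
    have hx0' : (x : ℂ) ≠ 0 := Complex.ofReal_ne_zero.2 hx0
    change hinner (⇑(RK v)) u = _
    rw [hgoal, eq_div_iff (mul_ne_zero hx0' hJ0)]
    linear_combination (x : ℂ) * hF + (1 - (x : ℂ) * inner ℂ (A oneH) (RK v)) * hG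
  · have hp := rank_one_resolvent hinj hAA hgg hff (hK oneH)
    have hF := congrArg (inner ℂ (A oneH)) hp
    have hE := congrArg (inner ℂ oneH) hp
    rw [inner_sub_right, inner_smul_right] at hF hE
    rw [hfu] at hF
    rw [← coe_oneH, Hardy.hinner_eq, hE, ← hJe, ← hcZ, sub_right_inj, eq_div_iff hJ0]
    linear_combination (x : ℂ) * conj Z * hF - (x : ℂ) * inner ℂ (A oneH) (RK oneH) * conj Z * hG


end
end
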